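/- (Independent magnons attain the bounding line) Let E₁ be the smallest eigenvalue of H₁ (the one-magnon block of H), and let x_1, …, x_a ∈ ℂ^V be nonzero vectors with H₁ x_i = E₁ x_i whose supports S_1, …, S_a ⊆ V are pairwise disjoint and mutually non-adjacent (no edge of G joins S_i to S_k for i ≠ k). Then the a-magnon state Φ = Σ_{n_1 ∈ S_1, …, n_a ∈ S_a} x_1(n_1)⋯x_a(n_a) · e_{σ(n_1,…,n_a)}, where σ(n_1,…,n_a) is the configuration with down-set {n_1,…,n_a}, is a nonzero eigenvector of H with eigenvalue (1−a)·N·j/8 + a·E₁, and this eigenvalue equals the smallest eigenvalue E_a of H on ℋ_a. -/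

import Mathlib

open Matrix BigOperators
open scoped ComplexOrder

/-- Spin-1/2 configurations: `true` means spin down. -/
abbrev Conf (V : Type*) := V → Bool

variable {V : Type*}

/-- The operator `P_{uv}` interchanging the spin values at sites `u` and `v`. -/
noncomputable def swapOp [Fintype V] [DecidableEq V] (u v : V) :
    Matrix (Conf V) (Conf V) ℂ :=
  Matrix.of fun σ τ => if τ = σ ∘ (Equiv.swap u v) then 1 else 0

lemma swapOp_comm [Fintype V] [DecidableEq V] (u v : V) :
    swapOp (V := V) u v = swapOp v u := by
  unfold swapOp
  rw [Equiv.swap_comm]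

/-- The spin-1/2 Heisenberg Hamiltonian `H = Σ_{{u,v} ∈ E(G)} ((1/2)·P_{uv} − (1/4)·Id)`. -/
noncomputable def Ham [Fintype V] [DecidableEq V] (G : SimpleGraph V) [DecidableRel G.Adj] :
    Matrix (Conf V) (Conf V) ℂ :=
  ∑ e ∈ G.edgeFinset,
    Sym2.lift ⟨fun u v => (1/2 : ℂ) • swapOp u v - (1/4 : ℂ) • 1,
      fun u v => by dsimp only; rw [swapOp_comm]⟩ e

/-- The configuration `σ_n` whose single down spin is at `n`. -/
def singleDown [DecidableEq V] (n : V) : Conf V := fun w => decide (w = n)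

/-- The one-magnon block `H₁` of `H`, as a matrix indexed by `V`
(via the identification `e_{σ_n} ↦ e_n`). -/
noncomputable def H1 [Fintype V] [DecidableEq V] (G : SimpleGraph V) [DecidableRel G.Adj] :
    Matrix V V ℂ :=
  Matrix.of fun m n => Ham G (singleDown m) (singleDown n)

/-- Number of down spins `|A_σ|` of a configuration. -/
def downCard [Fintype V] (σ : Conf V) : ℕ := (Finset.univ.filter fun u => σ u = true).card

/-- `e(A_σ, V∖A_σ)`: the number of edges joining the down-set to its complement. -/
noncomputable def crossCount (G : SimpleGraph V) (σ : Conf V) : ℕ :=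
  {e : Sym2 V | e ∈ G.edgeSet ∧ ∃ u v : V, σ u = true ∧ σ v = false ∧ e = s(u, v)}.ncard

/-- `e(A_σ)`: the number of edges with both endpoints in the down-set. -/
noncomputable def inCount (G : SimpleGraph V) (σ : Conf V) : ℕ :=
  {e : Sym2 V | e ∈ G.edgeSet ∧ ∀ u ∈ e, σ u = true}.ncard

lemma sum_dart_edge [Fintype V] [DecidableEq V] (G : SimpleGraph V) [DecidableRel G.Adj]
    {M : Type*} [AddCommMonoid M] (f : Sym2 V → M) :
    ∑ d : G.Dart, f d.edge = 2 • ∑ e ∈ G.edgeFinset, f e := by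
  rw [← Finset.sum_fiberwise_of_maps_to (g := SimpleGraph.Dart.edge) (t := G.edgeFinset)
    (fun d _ => SimpleGraph.mem_edgeFinset.2 d.edge_mem), Finset.smul_sum]
  refine Finset.sum_congr rfl fun e he => ?_
  rw [Finset.sum_congr rfl fun d hd => by rw [(Finset.mem_filter.1 hd).2], Finset.sum_const,
    G.dart_edge_fiber_card e (SimpleGraph.mem_edgeFinset.1 he)]

lemma card_dart_of_regular [Fintype V] (G : SimpleGraph V) [DecidableRel G.Adj]
    {j : ℕ} (hreg : G.IsRegularOfDegree j) : Fintype.card G.Dart = Fintype.card V * j := by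
  simp [G.dart_card_eq_sum_degrees, hreg.degree_eq]

lemma swapOp_mulVec_apply [Fintype V] [DecidableEq V] (u v : V) (ψ : Conf V → ℂ) (σ : Conf V) :
    (swapOp u v *ᵥ ψ) σ = ψ (σ ∘ Equiv.swap u v) := by
  simp [swapOp, mulVec, dotProduct]

lemma swapOp_isHermitian [Fintype V] [DecidableEq V] (u v : V) :
    (swapOp (V := V) u v).IsHermitian := by
  ext σ τ
  have h : σ = τ ∘ Equiv.swap u v ↔ τ = σ ∘ Equiv.swap u v := by
    constructor <;> rintro rfl <;> ext w <;> simp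
  simp only [swapOp, conjTranspose_apply, of_apply, h]
  split_ifs <;> simp

lemma Ham_isHermitian [Fintype V] [DecidableEq V] (G : SimpleGraph V) [DecidableRel G.Adj] :
    (Ham G).IsHermitian := by
  refine isSelfAdjoint_sum _ fun e _ => ?_
  induction e with | _ u v
  refine .sub (.smul ?_ (swapOp_isHermitian u v)) (.smul ?_ (.one _)) <;>
    simp [isSelfAdjoint_iff]

/-- The contribution `(1/2)·P_{uv} − (1/4)·Id` of a bond to the Hamiltonian. -/
noncomputable def bondOp [Fintype V] [DecidableEq V] (e : Sym2 V) :
    Matrix (Conf V) (Conf V) ℂ :=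
  Sym2.lift ⟨fun u v => (1/2 : ℂ) • swapOp u v - (1/4 : ℂ) • 1,
    fun u v => by dsimp only; rw [swapOp_comm]⟩ e

lemma bondOp_dart_mulVec_apply [Fintype V] [DecidableEq V] {G : SimpleGraph V} (d : G.Dart)
    (ψ : Conf V → ℂ) (σ : Conf V) :
    (bondOp d.edge *ᵥ ψ) σ
      = 1 / 2 * (ψ (σ ∘ Equiv.swap d.fst d.snd) - ψ σ) + 1 / 4 * ψ σ := by
  obtain ⟨⟨u, v⟩, _⟩ := d
  simp only [bondOp, SimpleGraph.Dart.edge, Sym2.lift_mk, sub_mulVec, smul_mulVec, one_mulVec,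
    Pi.sub_apply, Pi.smul_apply, swapOp_mulVec_apply, smul_eq_mul]
  ring

/-- The Hamiltonian as a sum over oriented edges. -/
lemma Ham_mulVec_apply [Fintype V] [DecidableEq V] (G : SimpleGraph V) [DecidableRel G.Adj]
    (ψ : Conf V → ℂ) (σ : Conf V) :
    (Ham G *ᵥ ψ) σ = (Fintype.card G.Dart / 8 : ℂ) * ψ σ
      + 1 / 4 * ∑ d : G.Dart, (ψ (σ ∘ Equiv.swap d.fst d.snd) - ψ σ) := by
  have h := sum_dart_edge G fun e => (bondOp e *ᵥ ψ) σ
  have hHam : ∑ e ∈ G.edgeFinset, (bondOp e *ᵥ ψ) σ = (Ham G *ᵥ ψ) σ := by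
    rw [← Finset.sum_apply, ← sum_mulVec]
    rfl
  rw [hHam, Finset.sum_congr rfl fun d _ => bondOp_dart_mulVec_apply d ψ σ,
    Finset.sum_add_distrib, ← Finset.mul_sum, Finset.sum_const, Finset.card_univ, nsmul_eq_mul,
    nsmul_eq_mul] at h
  push_cast at h
  linear_combination -h / 2

lemma singleDown_injective [DecidableEq V] : Function.Injective (singleDown (V := V)) := by
  intro m n h
  simpa [singleDown] using congrFun h m

lemma singleDown_comp_swap [DecidableEq V] (u v m : V) :
    singleDown m ∘ Equiv.swap u v = singleDown (Equiv.swap u v m) := by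
  ext w
  simp [singleDown, Equiv.swap_apply_eq_iff]

lemma H1_mulVec_apply [Fintype V] [DecidableEq V] (G : SimpleGraph V) [DecidableRel G.Adj]
    (x : V → ℂ) (m : V) :
    (H1 G *ᵥ x) m = (Fintype.card G.Dart / 8 : ℂ) * x m
      + 1 / 4 * ∑ d : G.Dart, (x (Equiv.swap d.fst d.snd m) - x m) := by
  have hX : ∀ n, (∑ k, x k • (Pi.single (singleDown k) 1 : Conf V → ℂ)) (singleDown n) = x n := by
    simp [Pi.single_apply, singleDown_injective.eq_iff]
  have h := Ham_mulVec_apply G (∑ k, x k • (Pi.single (singleDown k) 1 : Conf V → ℂ))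
    (singleDown m)
  simp only [singleDown_comp_swap, hX] at h
  rw [← h, mulVec_sum, Finset.sum_apply]
  simp [H1, mulVec, dotProduct, Pi.single_apply, mul_comm]

lemma H1_isHermitian [Fintype V] [DecidableEq V] (G : SimpleGraph V) [DecidableRel G.Adj] :
    (H1 G).IsHermitian :=
  (Ham_isHermitian G).submatrix singleDown

/-- The Rayleigh bound for a Hermitian matrix whose real eigenvalues are bounded below. -/
lemma Matrix.IsHermitian.le_re_dotProduct_mulVec {n : Type*} [Fintype n] [DecidableEq n]
    {A : Matrix n n ℂ} (hA : A.IsHermitian) {E : ℝ}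
    (hE : E ∈ lowerBounds {E : ℝ | ∃ x : n → ℂ, x ≠ 0 ∧ A *ᵥ x = (E : ℂ) • x}) (x : n → ℂ) :
    E * ∑ m, ‖x m‖ ^ 2 ≤ (star x ⬝ᵥ (A *ᵥ x)).re := by
  have hB : (A - (E : ℂ) • 1).IsHermitian := hA.sub
    (IsSelfAdjoint.smul (by simp [isSelfAdjoint_iff]) (.one _))
  have hpos : (A - (E : ℂ) • 1).PosSemidef := by
    refine hB.posSemidef_iff_eigenvalues_nonneg.2 fun i => ?_
    have hv := hB.mulVec_eigenvectorBasis i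
    have hle : E ≤ hB.eigenvalues i + E := hE ⟨_, fun h0 =>
      hB.eigenvectorBasis.orthonormal.ne_zero i (by ext k; exact congrFun h0 k), by
        rw [sub_mulVec, smul_mulVec, one_mulVec, sub_eq_iff_eq_add] at hv
        rw [hv, Complex.ofReal_add, add_smul]
        rfl⟩
    simpa using hle
  have h := (Complex.le_def.1 (hpos.dotProduct_mulVec_nonneg x)).1
  have hn : (star x ⬝ᵥ x).re = ∑ m, ‖x m‖ ^ 2 := by
    simp [dotProduct, Complex.sq_norm, Complex.normSq_apply]
  rw [sub_mulVec, smul_mulVec, one_mulVec, dotProduct_sub, dotProduct_smul, smul_eq_mul,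
    Complex.sub_re, Complex.re_ofReal_mul, hn] at h
  simpa using h

/-- The energy of a state in terms of its Dirichlet form, for operators built from permutations. -/
lemma re_dotProduct_eq_sub_dirichlet {α ι : Type*} [Fintype α] [Fintype ι] (π : ι → Equiv.Perm α)
    (c : ℝ) (x y : α → ℂ)
    (hy : ∀ m, y m = c * x m + 1 / 4 * ∑ d, (x (π d m) - x m)) :
    (star x ⬝ᵥ y).re
      = c * ∑ m, ‖x m‖ ^ 2 - 1 / 8 * ∑ d, ∑ m, ‖x m - x (π d m)‖ ^ 2 := by
  have h1 : ∀ a b : ℂ, (star a * (b - a)).re = 1 / 2 * (‖b‖ ^ 2 - ‖a‖ ^ 2 - ‖a - b‖ ^ 2) := by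
    intro a b
    simp only [Complex.sq_norm, Complex.normSq_apply, Complex.mul_re, Complex.sub_re,
      Complex.sub_im, Complex.star_def, Complex.conj_re, Complex.conj_im]
    ring
  have h2 : ∀ m, (star (x m) * y m).re = c * ‖x m‖ ^ 2
      + 1 / 8 * ∑ d, (‖x (π d m)‖ ^ 2 - ‖x m‖ ^ 2 - ‖x m - x (π d m)‖ ^ 2) := by
    intro m
    have e1 : star (x m) * y m = ((c * ‖x m‖ ^ 2 : ℝ) : ℂ)
        + ((1 / 4 : ℝ) : ℂ) * ∑ d, star (x m) * (x (π d m) - x m) := by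
      rw [hy, ← Finset.mul_sum]
      have := Complex.conj_mul' (x m)
      push_cast
      rw [Complex.star_def]
      linear_combination (c : ℂ) * this
    rw [e1, Complex.add_re, Complex.ofReal_re, Complex.re_ofReal_mul, Complex.re_sum,
      Finset.sum_congr rfl fun d _ => h1 _ _, ← Finset.mul_sum]
    ring
  have h3 : ∀ d, ∑ m, ‖x (π d m)‖ ^ 2 = ∑ m, ‖x m‖ ^ 2 :=
    fun d => Equiv.sum_comp (π d) fun m => ‖x m‖ ^ 2
  simp only [dotProduct, Pi.star_apply, Complex.re_sum, h2]
  rw [Finset.sum_add_distrib, ← Finset.mul_sum, ← Finset.mul_sum, Finset.sum_comm]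
  simp only [Finset.sum_sub_distrib, h3]
  ring

lemma sum_normSq_sub_swap [Fintype V] [DecidableEq V] (x : V → ℂ) {u v : V} (huv : u ≠ v) :
    ∑ m, ‖x m - x (Equiv.swap u v m)‖ ^ 2 = 2 * ‖x u - x v‖ ^ 2 := by
  rw [Fintype.sum_eq_add u v huv]
  · simp only [Equiv.swap_apply_left, Equiv.swap_apply_right, norm_sub_rev (x v)]
    ring
  · rintro m ⟨hu, hv⟩
    simp [Equiv.swap_apply_of_ne_of_ne hu hv]

/-- The spectral gap bound for the one-magnon Dirichlet form. -/
lemma dirichlet_le [Fintype V] [DecidableEq V] (G : SimpleGraph V) [DecidableRel G.Adj] {E : ℝ}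
    (hE : E ∈ lowerBounds {E : ℝ | ∃ x : V → ℂ, x ≠ 0 ∧ H1 G *ᵥ x = (E : ℂ) • x}) (x : V → ℂ) :
    ∑ d : G.Dart, ‖x d.fst - x d.snd‖ ^ 2
      ≤ 4 * (Fintype.card G.Dart / 8 - E) * ∑ m, ‖x m‖ ^ 2 := by
  have h := (H1_isHermitian G).le_re_dotProduct_mulVec hE x
  rw [re_dotProduct_eq_sub_dirichlet (fun d : G.Dart => Equiv.swap d.fst d.snd)
    (Fintype.card G.Dart / 8) x _ fun m => by rw [H1_mulVec_apply]; push_cast; rfl] at h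
  rw [Finset.sum_congr rfl fun d _ => sum_normSq_sub_swap x d.adj.ne, ← Finset.mul_sum] at h
  linarith

/-- Reversing the spin at `u`. -/
def flipAt [DecidableEq V] (u : V) : Equiv.Perm (Conf V) where
  toFun σ := Function.update σ u (!σ u)
  invFun σ := Function.update σ u (!σ u)
  left_inv σ := by simp
  right_inv σ := by simp

lemma flipAt_apply_self [DecidableEq V] (u : V) (σ : Conf V) : flipAt u σ u = !σ u := by
  simp [flipAt]

lemma flipAt_apply_of_ne [DecidableEq V] {u v : V} (h : v ≠ u) (σ : Conf V) :
    flipAt u σ v = σ v := by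
  simp [flipAt, h]

lemma flipAt_comp_swap [DecidableEq V] {u v : V} {σ : Conf V} (h : σ u = σ v) :
    flipAt u σ ∘ Equiv.swap u v = flipAt v σ := by
  ext w
  rcases eq_or_ne w u with rfl | hu
  · rcases eq_or_ne w v with rfl | huv
    · simp
    · simp [flipAt_apply_of_ne huv, flipAt_apply_of_ne huv.symm, h]
  · rcases eq_or_ne w v with rfl | hv
    · simp [flipAt_apply_self, h]
    · simp [Equiv.swap_apply_of_ne_of_ne hu hv, flipAt_apply_of_ne hu, flipAt_apply_of_ne hv]

/-- The amplitude for a further magnon at `u` on top of `τ`, extended by zero to the down-set. -/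
def extraMagnon [DecidableEq V] (ψ : Conf V → ℂ) (τ : Conf V) (u : V) : ℂ :=
  if τ u = true then 0 else ψ (flipAt u τ)

lemma sum_down_up_le [Fintype V] [DecidableEq V] (ψ : Conf V → ℂ) {u v : V} (huv : u ≠ v) :
    ∑ σ : Conf V, (if σ u = true ∧ σ v = false then
      ‖ψ σ - ψ (σ ∘ Equiv.swap u v)‖ ^ 2 else 0)
      ≤ ∑ τ, ‖extraMagnon ψ τ u - extraMagnon ψ τ v‖ ^ 2 := by
  rw [← Equiv.sum_comp (flipAt u)]
  refine Finset.sum_le_sum fun τ _ => ?_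
  rw [flipAt_apply_self, flipAt_apply_of_ne huv.symm]
  split_ifs with h
  · have hu : τ u = false := by simpa using h.1
    rw [flipAt_comp_swap (hu.trans h.2.symm)]
    simp [extraMagnon, hu, h.2]
  · positivity

lemma sum_normSq_sub_comp_swap_le [Fintype V] [DecidableEq V] (ψ : Conf V → ℂ) {u v : V}
    (huv : u ≠ v) :
    ∑ σ, ‖ψ σ - ψ (σ ∘ Equiv.swap u v)‖ ^ 2
      ≤ 2 * ∑ τ, ‖extraMagnon ψ τ u - extraMagnon ψ τ v‖ ^ 2 := by
  have h1 := sum_down_up_le ψ huv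
  have h2 := sum_down_up_le ψ huv.symm
  simp only [Equiv.swap_comm v u, norm_sub_rev (extraMagnon ψ _ v)] at h2
  refine le_trans (le_of_eq ?_) ((add_le_add h1 h2).trans_eq (two_mul _).symm)
  rw [← Finset.sum_add_distrib]
  refine Finset.sum_congr rfl fun σ _ => ?_
  have h : σ u = σ v → σ ∘ Equiv.swap u v = σ := by
    intro h
    ext w
    rcases eq_or_ne w u with rfl | hu
    · simp [h]
    · rcases eq_or_ne w v with rfl | hv
      · simp [h]
      · simp [Equiv.swap_apply_of_ne_of_ne hu hv]
  cases hu : σ u <;> cases hv : σ v <;> simp [hu, hv, h]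

lemma sum_normSq_extraMagnon [Fintype V] [DecidableEq V] (ψ : Conf V → ℂ) :
    ∑ τ, ∑ u, ‖extraMagnon ψ τ u‖ ^ 2 = ∑ σ, downCard σ * ‖ψ σ‖ ^ 2 := by
  have h : ∀ u, ∑ τ, ‖extraMagnon ψ τ u‖ ^ 2 = ∑ σ, if σ u = true then ‖ψ σ‖ ^ 2 else 0 := by
    intro u
    rw [← Equiv.sum_comp (flipAt u) fun σ => if σ u = true then ‖ψ σ‖ ^ 2 else 0]
    refine Finset.sum_congr rfl fun τ _ => ?_
    cases hu : τ u <;> simp [extraMagnon, flipAt_apply_self, hu]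
  rw [Finset.sum_comm, Finset.sum_congr rfl fun u _ => h u, Finset.sum_comm]
  refine Finset.sum_congr rfl fun σ _ => ?_
  rw [← Finset.sum_filter, Finset.sum_const, nsmul_eq_mul, downCard]

/-- Energies in the `a`-magnon sector lie above the line through the zero- and one-magnon
ground state energies. -/
lemma le_of_Ham_mulVec_eq_smul [Fintype V] [DecidableEq V] (G : SimpleGraph V)
    [DecidableRel G.Adj] {a : ℕ} {E1 E : ℝ}
    (hE1 : E1 ∈ lowerBounds {E : ℝ | ∃ x : V → ℂ, x ≠ 0 ∧ H1 G *ᵥ x = (E : ℂ) • x})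
    {ψ : Conf V → ℂ} (hψ0 : ψ ≠ 0) (hψa : ∀ σ, ψ σ ≠ 0 → downCard σ = a)
    (hψ : Ham G *ᵥ ψ = (E : ℂ) • ψ) :
    (Fintype.card G.Dart / 8 : ℝ) + a * (E1 - Fintype.card G.Dart / 8) ≤ E := by
  have hn : (star ψ ⬝ᵥ ψ).re = ∑ σ, ‖ψ σ‖ ^ 2 := by
    simp [dotProduct, Complex.sq_norm, Complex.normSq_apply]
  have hpos : 0 < ∑ σ, ‖ψ σ‖ ^ 2 := by
    obtain ⟨σ, hσ⟩ := Function.ne_iff.1 hψ0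
    exact Finset.sum_pos' (fun _ _ => by positivity)
      ⟨σ, Finset.mem_univ _, pow_pos (norm_pos_iff.2 hσ) 2⟩
  have hE := re_dotProduct_eq_sub_dirichlet
    (fun d : G.Dart => (Equiv.swap d.fst d.snd).arrowCongr (Equiv.refl Bool))
    (Fintype.card G.Dart / 8) ψ (Ham G *ᵥ ψ) fun σ => by
      rw [Ham_mulVec_apply]; push_cast; rfl
  rw [hψ, dotProduct_smul, smul_eq_mul, Complex.re_ofReal_mul, hn] at hE
  have hD : ∑ d : G.Dart, ∑ σ, ‖ψ σ - ψ (σ ∘ Equiv.swap d.fst d.snd)‖ ^ 2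
      ≤ 8 * (Fintype.card G.Dart / 8 - E1) * (a * ∑ σ, ‖ψ σ‖ ^ 2) := by
    calc _ ≤ ∑ d : G.Dart, 2 * ∑ τ, ‖extraMagnon ψ τ d.fst - extraMagnon ψ τ d.snd‖ ^ 2 :=
          Finset.sum_le_sum fun d _ => sum_normSq_sub_comp_swap_le ψ d.adj.ne
      _ = 2 * ∑ τ, ∑ d : G.Dart, ‖extraMagnon ψ τ d.fst - extraMagnon ψ τ d.snd‖ ^ 2 := by
          rw [← Finset.mul_sum, Finset.sum_comm]
      _ ≤ 2 * ∑ τ, 4 * (Fintype.card G.Dart / 8 - E1) * ∑ u, ‖extraMagnon ψ τ u‖ ^ 2 := by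
          gcongr with τ
          exact dirichlet_le G hE1 _
      _ = 8 * (Fintype.card G.Dart / 8 - E1) * ∑ σ, downCard σ * ‖ψ σ‖ ^ 2 := by
          rw [← Finset.mul_sum, sum_normSq_extraMagnon]
          ring
      _ = _ := by
          rw [Finset.mul_sum (a := (a : ℝ))]
          congr 1
          refine Finset.sum_congr rfl fun σ _ => ?_
          by_cases h : ψ σ = 0
          · simp [h]
          · rw [hψa σ h]
  have hE' : E * ∑ σ, ‖ψ σ‖ ^ 2 = Fintype.card G.Dart / 8 * ∑ σ, ‖ψ σ‖ ^ 2
      - 1 / 8 * ∑ d : G.Dart, ∑ σ, ‖ψ σ - ψ (σ ∘ Equiv.swap d.fst d.snd)‖ ^ 2 := hE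
  refine le_of_mul_le_mul_right ?_ hpos
  linarith

/-- The configuration with down-set `{n i | i}`. -/
def tupleDown [DecidableEq V] {ι : Type*} [Fintype ι] (n : ι → V) : Conf V :=
  fun w => decide (∃ i, n i = w)

lemma tupleDown_comp_swap [DecidableEq V] {ι : Type*} [Fintype ι] (u v : V) (n : ι → V) :
    tupleDown (Equiv.swap u v ∘ n) ∘ Equiv.swap u v = tupleDown n := by
  ext w
  simp [tupleDown]

lemma downCard_tupleDown [Fintype V] [DecidableEq V] {ι : Type*} [Fintype ι] {n : ι → V}
    (hn : Function.Injective n) : downCard (tupleDown n) = Fintype.card ι := by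
  classical
  rw [downCard, ← Finset.card_univ, ← Finset.card_image_of_injective _ hn]
  congr 1
  ext w
  simp [tupleDown]

/-- The symmetrised state built from an amplitude `F` on tuples of sites. -/
noncomputable def tupleState [Fintype V] [DecidableEq V] {ι : Type*} [Fintype ι] [DecidableEq ι]
    (F : (ι → V) → ℂ) : Conf V → ℂ :=
  ∑ n : ι → V, F n • (Pi.single (tupleDown n) 1 : Conf V → ℂ)

lemma tupleState_apply [Fintype V] [DecidableEq V] {ι : Type*} [Fintype ι] [DecidableEq ι]
    (F : (ι → V) → ℂ) (σ : Conf V) :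
    tupleState F σ = ∑ n, if σ = tupleDown n then F n else 0 := by
  simp [tupleState, Pi.single_apply]

lemma tupleState_comp_swap [Fintype V] [DecidableEq V] {ι : Type*} [Fintype ι] [DecidableEq ι]
    (F : (ι → V) → ℂ) (σ : Conf V) (u v : V) :
    tupleState F (σ ∘ Equiv.swap u v)
      = ∑ n, if σ = tupleDown n then F (Equiv.swap u v ∘ n) else 0 := by
  rw [tupleState_apply, ← Equiv.sum_comp ((Equiv.refl ι).arrowCongr (Equiv.swap u v))]
  refine Finset.sum_congr rfl fun n _ => ?_
  have h : σ ∘ Equiv.swap u v = tupleDown (Equiv.swap u v ∘ n) ↔ σ = tupleDown n := by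
    rw [← tupleDown_comp_swap u v n]
    constructor
    · intro h
      rw [← h]
      ext w
      simp
    · rintro rfl
      ext w
      simp
  exact if_congr h rfl rfl

lemma Ham_mulVec_tupleState [Fintype V] [DecidableEq V] (G : SimpleGraph V) [DecidableRel G.Adj]
    {ι : Type*} [Fintype ι] [DecidableEq ι] (F : (ι → V) → ℂ) (c : ℂ)
    (hF : ∀ n, ∑ d : G.Dart, (F (Equiv.swap d.fst d.snd ∘ n) - F n) = c * F n) :
    Ham G *ᵥ tupleState F = (Fintype.card G.Dart / 8 + c / 4 : ℂ) • tupleState F := by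
  ext σ
  have h : ∑ d : G.Dart, (tupleState F (σ ∘ Equiv.swap d.fst d.snd) - tupleState F σ)
      = c * tupleState F σ := by
    simp only [tupleState_comp_swap]
    simp only [tupleState_apply, ← Finset.sum_sub_distrib, Finset.mul_sum]
    rw [Finset.sum_comm]
    refine Finset.sum_congr rfl fun n _ => ?_
    split_ifs
    · exact hF n
    · simp
  rw [Ham_mulVec_apply, h, Pi.smul_apply, smul_eq_mul]
  ring

/-- For amplitudes with separated supports, exchanging the ends of an edge moves at most one
magnon. -/
lemma prod_swap_sub_prod [DecidableEq V] (G : SimpleGraph V) {ι : Type*} [Fintype ι]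
    [DecidableEq ι] (x : ι → V → ℂ)
    (hsep : ∀ i k, i ≠ k → ∀ u v : V, x i u ≠ 0 → x k v ≠ 0 → u ≠ v ∧ ¬ G.Adj u v)
    {u v : V} (huv : G.Adj u v) (n : ι → V) :
    ∏ i, x i (Equiv.swap u v (n i)) - ∏ i, x i (n i)
      = ∑ i, (∏ k ∈ Finset.univ.erase i, x k (n k)) * (x i (Equiv.swap u v (n i)) - x i (n i)) := by
  by_cases hnear : ∃ i k, i ≠ k ∧ (n i = u ∨ n i = v) ∧ (n k = u ∨ n k = v)
  · obtain ⟨i, k, hik, hi, hk⟩ := hnear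
    have hz : ∀ p q : V, (p = u ∨ p = v) → (q = u ∨ q = v) → x i p = 0 ∨ x k q = 0 := by
      intro p q hp hq
      by_contra! h
      have := hsep i k hik p q h.1 h.2
      rcases hp with rfl | rfl <;> rcases hq with rfl | rfl <;> simp_all [G.adj_comm]
    have hs : ∀ p, (p = u ∨ p = v) → (Equiv.swap u v p = u ∨ Equiv.swap u v p = v) := by
      rintro p (rfl | rfl) <;> simp
    have hzero : ∀ y : ι → V, (y i = u ∨ y i = v) → (y k = u ∨ y k = v) →
        ∏ l, x l (y l) = 0 := by
      intro y hyi hyk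
      rcases hz _ _ hyi hyk with h | h
      · exact Finset.prod_eq_zero (Finset.mem_univ i) h
      · exact Finset.prod_eq_zero (Finset.mem_univ k) h
    rw [hzero n hi hk, hzero (fun l => Equiv.swap u v (n l)) (hs _ hi) (hs _ hk), sub_zero]
    refine (Finset.sum_eq_zero fun l _ => ?_).symm
    have hup : ∀ m, (∏ k ∈ Finset.univ.erase l, x k (n k)) * x l m
        = ∏ k, x k (Function.update n l m k) := by
      intro m
      rw [← Finset.prod_erase_mul _ _ (Finset.mem_univ l), Function.update_self]
      congr 1
      refine Finset.prod_congr rfl fun k hk => ?_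
      rw [Function.update_of_ne (Finset.ne_of_mem_erase hk)]
    have hmem : ∀ k, (n k = u ∨ n k = v) →
        (Function.update n l (Equiv.swap u v (n l)) k = u ∨
          Function.update n l (Equiv.swap u v (n l)) k = v) := by
      intro k hk
      rcases eq_or_ne k l with rfl | hkl
      · rw [Function.update_self]
        exact hs _ hk
      · rwa [Function.update_of_ne hkl]
    rw [mul_sub, hup, hup, Function.update_eq_self, hzero n hi hk,
      hzero _ (hmem i hi) (hmem k hk), sub_zero]
  · push Not at hnear
    have hfix : ∀ m : V, ¬ (m = u ∨ m = v) → Equiv.swap u v m = m := by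
      intro m hm
      push Not at hm
      exact Equiv.swap_apply_of_ne_of_ne hm.1 hm.2
    by_cases hone : ∃ i, n i = u ∨ n i = v
    · obtain ⟨i, hi⟩ := hone
      have hother : ∀ k, k ≠ i → Equiv.swap u v (n k) = n k := fun k hk =>
        Equiv.swap_apply_of_ne_of_ne (hnear i k hk.symm hi).1 (hnear i k hk.symm hi).2
      rw [Finset.sum_eq_single i (fun k _ hk => by rw [hother k hk, sub_self, mul_zero]) (by simp),
        ← Finset.prod_erase_mul _ _ (Finset.mem_univ i),
        ← Finset.prod_erase_mul Finset.univ (fun i => x i (n i)) (Finset.mem_univ i),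
        Finset.prod_congr rfl fun k hk => by rw [hother k (Finset.ne_of_mem_erase hk)], mul_sub]
    · have hall : ∀ i, Equiv.swap u v (n i) = n i := fun i => hfix _ fun h => hone ⟨i, h⟩
      simp [hall]

lemma sum_dart_prod_swap_sub [Fintype V] [DecidableEq V] (G : SimpleGraph V) [DecidableRel G.Adj]
    {ι : Type*} [Fintype ι] [DecidableEq ι] (x : ι → V → ℂ) {E : ℂ}
    (hxe : ∀ i, H1 G *ᵥ x i = E • x i)
    (hsep : ∀ i k, i ≠ k → ∀ u v : V, x i u ≠ 0 → x k v ≠ 0 → u ≠ v ∧ ¬ G.Adj u v)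
    (n : ι → V) :
    ∑ d : G.Dart, (∏ i, x i (Equiv.swap d.fst d.snd (n i)) - ∏ i, x i (n i))
      = 4 * Fintype.card ι * (E - Fintype.card G.Dart / 8) * ∏ i, x i (n i) := by
  have h : ∀ i, ∑ d : G.Dart, (x i (Equiv.swap d.fst d.snd (n i)) - x i (n i))
      = 4 * (E - Fintype.card G.Dart / 8) * x i (n i) := by
    intro i
    have := congrFun (hxe i) (n i)
    rw [H1_mulVec_apply, Pi.smul_apply, smul_eq_mul] at this
    linear_combination 4 * this
  rw [Finset.sum_congr rfl fun d _ => prod_swap_sub_prod G x hsep d.adj n, Finset.sum_comm]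
  simp only [← Finset.mul_sum, h]
  rw [Finset.sum_congr rfl fun i _ => show _ = 4 * (E - Fintype.card G.Dart / 8)
    * ∏ i, x i (n i) by rw [← Finset.prod_erase_mul _ _ (Finset.mem_univ i)]; ring]
  rw [Finset.sum_const, Finset.card_univ, nsmul_eq_mul]
  ring

lemma tupleState_prod_ne_zero [Fintype V] [DecidableEq V] {ι : Type*} [Fintype ι] [DecidableEq ι]
    (x : ι → V → ℂ) (hx0 : ∀ i, x i ≠ 0)
    (hdisj : ∀ i k, i ≠ k → ∀ u v : V, x i u ≠ 0 → x k v ≠ 0 → u ≠ v) :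
    tupleState (fun n : ι → V => ∏ i, x i (n i)) ≠ 0 := by
  choose n hn using fun i => Function.ne_iff.1 (hx0 i)
  refine Function.ne_iff.2 ⟨tupleDown n, ?_⟩
  rw [tupleState_apply, Finset.sum_eq_single n]
  · simpa [Finset.prod_eq_zero_iff] using hn
  · intro n' _ hne
    refine ite_eq_right_iff.2 fun hσ => ?_
    by_contra hprod
    refine hne (funext fun i => ?_)
    have hi : x i (n' i) ≠ 0 := Finset.prod_ne_zero_iff.1 hprod i (Finset.mem_univ i)
    obtain ⟨k, hk⟩ : ∃ k, n k = n' i := by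
      simpa [tupleDown] using congrFun hσ (n' i)
    obtain rfl : i = k := by
      by_contra hik
      exact hdisj i k hik _ _ hi (hn k) hk.symm
    exact hk.symm
  · simp

lemma downCard_of_tupleState_prod_ne_zero [Fintype V] [DecidableEq V] {ι : Type*} [Fintype ι]
    [DecidableEq ι] (x : ι → V → ℂ)
    (hdisj : ∀ i k, i ≠ k → ∀ u v : V, x i u ≠ 0 → x k v ≠ 0 → u ≠ v) {σ : Conf V}
    (hσ : tupleState (fun n : ι → V => ∏ i, x i (n i)) σ ≠ 0) :
    downCard σ = Fintype.card ι := by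
  rw [tupleState_apply] at hσ
  obtain ⟨n, -, hn⟩ := Finset.exists_ne_zero_of_sum_ne_zero hσ
  obtain ⟨rfl, hprod⟩ := ite_ne_right_iff.1 hn
  refine downCard_tupleDown fun i k hik => ?_
  by_contra hne
  exact hdisj i k hne _ _ (Finset.prod_ne_zero_iff.1 hprod i (Finset.mem_univ i))
    (Finset.prod_ne_zero_iff.1 hprod k (Finset.mem_univ k)) hik

/-- (Independent magnons attain the bounding line) If `x_1, …, x_a` are one-magnon ground
states with pairwise disjoint, mutually non-adjacent supports, then the product state `Φ` is a
nonzero eigenvector of `H` with eigenvalue `(1−a)·N·j/8 + a·E₁`, which is the smallest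
eigenvalue of `H` on the `a`-magnon sector. -/
theorem independent_magnons [Fintype V] [DecidableEq V]
    (G : SimpleGraph V) [DecidableRel G.Adj] (N j : ℕ)
    (hN : Fintype.card V = N) (hreg : G.IsRegularOfDegree j)
    (a : ℕ) (ha : 1 ≤ a) (E1 : ℝ)
    (hE1 : IsLeast {E : ℝ | ∃ x : V → ℂ, x ≠ 0 ∧ H1 G *ᵥ x = (E : ℂ) • x} E1)
    (x : Fin a → V → ℂ) (hx0 : ∀ i, x i ≠ 0)
    (hxe : ∀ i, H1 G *ᵥ x i = (E1 : ℂ) • x i)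
    (hsep : ∀ i k : Fin a, i ≠ k → ∀ u v : V, x i u ≠ 0 → x k v ≠ 0 →
      u ≠ v ∧ ¬ G.Adj u v)
    (Φ : Conf V → ℂ)
    (hΦ : Φ = ∑ n : Fin a → V, (∏ i, x i (n i)) •
      (Pi.single (fun w => decide (∃ i, n i = w)) 1 : Conf V → ℂ)) :
    Φ ≠ 0
    ∧ Ham G *ᵥ Φ = (((1 - (a : ℝ)) * N * j / 8 + a * E1 : ℝ) : ℂ) • Φ
    ∧ IsLeast {E : ℝ | ∃ ψ : Conf V → ℂ, ψ ≠ 0 ∧ (∀ σ, ψ σ ≠ 0 → downCard σ = a)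
        ∧ Ham G *ᵥ ψ = (E : ℂ) • ψ} ((1 - (a : ℝ)) * N * j / 8 + a * E1) := by
  have hdisj := fun i k hik u v hu hv => (hsep i k hik u v hu hv).1
  have hcard : (Fintype.card G.Dart : ℝ) = N * j := by
    rw [card_dart_of_regular G hreg, hN, Nat.cast_mul]
  obtain rfl : Φ = tupleState fun n : Fin a → V => ∏ i, x i (n i) := by
    rw [hΦ]
    unfold tupleState tupleDown
    congr!
  have h0 := tupleState_prod_ne_zero x hx0 hdisj
  have heig : Ham G *ᵥ (tupleState fun n : Fin a → V => ∏ i, x i (n i))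
      = (((1 - (a : ℝ)) * N * j / 8 + a * E1 : ℝ) : ℂ)
        • tupleState fun n : Fin a → V => ∏ i, x i (n i) := by
    rw [Ham_mulVec_tupleState G _ _ (sum_dart_prod_swap_sub G x hxe hsep), Fintype.card_fin]
    congr 1
    have hcard' : (Fintype.card G.Dart : ℂ) = N * j := by exact_mod_cast hcard
    rw [hcard']
    push_cast
    ring
  refine ⟨h0, heig, ⟨_, h0, fun σ hσ => ?_, heig⟩, ?_⟩
  · simpa using downCard_of_tupleState_prod_ne_zero x hdisj hσ
  · rintro E ⟨ψ, hψ0, hψa, hψ⟩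
    have h := le_of_Ham_mulVec_eq_smul G hE1.2 hψ0 hψa hψ
    rw [hcard] at h
    linarith
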